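/- Let n ≥ 2 and let u ∈ C^∞(ℝⁿ) be strictly convex satisfying equation (1.4) on all of ℝⁿ. Then Φ ≡ 0 on ℝⁿ; equivalently, det(∂²u/∂ξ_i∂ξ_j) is a positive constant. -/

import Mathlib

noncomputable section

/-- The `i`-th partial derivative of a function on `ℝⁿ`. -/
def pd {n : ℕ} (i : Fin n) (f : (Fin n → ℝ) → ℝ) : (Fin n → ℝ) → ℝ :=
  fun x => fderiv ℝ f x (Pi.single i 1)

/-- The Hessian matrix `(∂²f/∂x_i∂x_j)`. -/
def hess {n : ℕ} (f : (Fin n → ℝ) → ℝ) (x : Fin n → ℝ) : Matrix (Fin n) (Fin n) ℝ :=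
  Matrix.of fun i j => pd i (pd j f) x

/-- `ρ = (det D²u)^{1/(n+2)}`. -/
def rhoU {n : ℕ} (u : (Fin n → ℝ) → ℝ) (x : Fin n → ℝ) : ℝ :=
  (hess u x).det ^ ((1 : ℝ) / (n + 2))

/-- `Φ = ‖∇ρ‖²/ρ²` with respect to the Calabi metric `G = D²u`. -/
def PhiU {n : ℕ} (u : (Fin n → ℝ) → ℝ) (x : Fin n → ℝ) : ℝ :=
  (1 / (rhoU u x) ^ 2) *
    ∑ i : Fin n, ∑ j : Fin n, (hess u x)⁻¹ i j * pd i (rhoU u) x * pd j (rhoU u) x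

open Matrix Filter Topology

set_option maxHeartbeats 800000 in
/-- Final scalar inequality. -/
theorem scalar_step (n P s W A2 τ v X σ Q : ℝ) (hn : 2 ≤ n) (hP : 0 < P) (hτ : 0 < τ)
    (h1 : (P + s)^2 / n ≤ A2 - 2 * W + s^2) (h2 : s^2 ≤ W)
    (hσ0 : 0 < σ) (hσ1 : σ < 1) (hσv : 0 ≤ v → 1/2 ≤ σ)
    (hX : X = s + (-(4*n*σ)) * P) (hXv : X * τ = 64 * n^3 * v)
    (hQ : Q ≤ 2 / (64*n^3) * (W / P + (4*n*σ)^2 * P))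
    (hmain : A2 / P - W / P - X - 64*n^3 * n/τ - Q + (-(8*σ*(1-σ))) * P ≤ 0) :
    P * τ ≤ 128 * n^5 := by
  have hn0 : 0 < n := by linarith
  have e1 : (A2 - W) / P ≥ ((P+s)^2 / n + W - s^2) / P := by
    apply div_le_div_of_nonneg_right _ hP.le; linarith
  have e2 : 2 / (64*n^3) * (W / P + (4*n*σ)^2 * P) ≤ 2 / (64*n^3) * (W/P) + P / (2*n) := by
    have : 2 / (64*n^3) * ((4*n*σ)^2 * P) = σ^2 * (P/(2*n)) := by field_simp; ring
    have h3 : σ^2 * (P/(2*n)) ≤ 1 * (P/(2*n)) := by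
      apply mul_le_mul_of_nonneg_right _ (by positivity); nlinarith only [hσ0, hσ1]
    rw [mul_add, this]; linarith
  set ε := 2 / (64*n^3) with hε
  have hε0 : 0 < ε := by positivity
  have hεn : ε ≤ 1 / (2 * n) * (1/4) := by
    rw [hε, div_mul_div_comm, div_le_div_iff₀ (by positivity) (by positivity)]
    nlinarith only [mul_pos hn0 hn0, mul_nonneg hn0.le (mul_nonneg (by linarith : 0 ≤ n - 2) (by linarith : 0 ≤ n + 2)), hn]
  have hε1 : ε ≤ 1 := by
    have : 1 / (2 * n) * (1/4) ≤ 1 := by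
      rw [div_mul_div_comm, div_le_one (by positivity)]; linarith
    linarith
  -- key bound
  have key : ((P+s)^2 / n - ε * s^2) / P - X - P/(2*n) - 8*σ*(1-σ) * P ≤ 64*n^3*n/τ := by
    have : ((P+s)^2 / n - ε * s^2) / P ≤ ((P+s)^2 / n + W - s^2) / P - ε * (W/P) := by
      rw [← mul_div_assoc, ← sub_div]
      apply div_le_div_of_nonneg_right _ hP.le
      nlinarith only [mul_nonneg (by linarith : 0 ≤ 1 - ε) (by linarith : 0 ≤ W - s^2)]
    have e3 : (A2 - W)/P = A2/P - W/P := sub_div _ _ _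
    linarith
  have fin : P / (2*n) ≤ 64*n^3*n/τ := by
    refine le_trans ?_ key
    obtain ⟨a, rfl⟩ : ∃ a, s = a * P := ⟨s / P, by field_simp⟩
    have e4 : ((P+a*P)^2 / n - ε * (a*P)^2) / P = P * ((1+a)^2 / n - ε * a^2) := by
      field_simp
    rw [e4]
    have e5 : P / (2*n) = P * (1/(2*n)) := by ring
    rw [e5]
    have hi : 1/n = 2 * (1/(2*n)) := by field_simp
    have hdiv : (1+a)^2/n = (1+a)^2 * (2 * (1/(2*n))) := by rw [← hi]; ring
    rw [hdiv]
    set δ := 1/(2*n) with hδ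
    have hδ0 : 0 < δ := by positivity
    have hnδ : n * δ = 1/2 := by rw [hδ]; field_simp
    rcases le_or_gt 0 v with hv | hv
    · have hs := hσv hv
      rw [hX]
      have : 0 ≤ (1+a)^2 * (2*δ) - ε * a^2 - a + 4*n*σ - 8*σ*(1-σ) - 2*δ := by
        have hk : n ≤ 4*n*σ - 8*σ*(1-σ) := by
          have r1 : 0 ≤ (σ - 1/2) * (n - 2) := mul_nonneg (by linarith) (by linarith)
          have r2 : 0 ≤ (σ - 1/2) * σ := mul_nonneg (by linarith) hσ0.le
          nlinarith only [r1, r2, hs, hn]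
        have h6 : ε * a^2 ≤ δ * (1/4) * a^2 := mul_le_mul_of_nonneg_right hεn (sq_nonneg a)
        have h7 : 0 ≤ n + (4*δ-1)*a + a^2 * (7/4*δ) := by
          have : 0 ≤ n * (n + (4*δ-1)*a + a^2 * (7/4*δ)) := by
            have e : n * (n + (4*δ-1)*a + a^2 * (7/4*δ)) = n^2 + (2 - n) * a + 7/8 * a^2 := by
              linear_combination (4 * a + 7/4*a^2) * hnδ
            rw [e]
            have q1 := sq_nonneg (a - 4/7*(n-2))
            have q2 : (n-2)^2 ≤ n^2 := by nlinarith
            nlinarith only [q1, q2, sq_nonneg n]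
          exact nonneg_of_mul_nonneg_right this hn0
        nlinarith only [hk, h6, h7]
      nlinarith only [mul_nonneg hP.le this]
    · have hXneg : X ≤ 0 := by
        have : X * τ < 0 := by rw [hXv]; exact mul_neg_of_pos_of_neg (by positivity) hv
        by_contra h; push Not at h
        exact absurd (mul_pos h hτ) (by linarith)
      have hX2 : X ≤ (4*δ) * X := by
        have h8 : 4 * δ ≤ 1 := by nlinarith only [hnδ, hn, hδ0]
        nlinarith only [h8, hXneg]
      have h5 : (4*δ)*X = P * (4*δ*a - 8*σ) := by
        rw [hX]; linear_combination (-16*σ*P)*hnδ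
      have : 0 ≤ (1+a)^2 * (2*δ) - ε * a^2 - (4*δ*a - 8*σ) - 8*σ*(1-σ) - 2*δ := by
        have h6 : ε * a^2 ≤ δ * (1/4) * a^2 := mul_le_mul_of_nonneg_right hεn (sq_nonneg a)
        nlinarith only [h6, sq_nonneg σ, mul_nonneg hδ0.le (sq_nonneg a)]
      nlinarith only [mul_nonneg hP.le this, hX2, h5]
  rw [div_le_div_iff₀ (by positivity) hτ] at fin
  nlinarith only [fin]

/-- Matrix inequality. -/
theorem matrix_ineq {n : ℕ} (hn : 0 < n) (A : Fin n → Fin n → ℝ) (hA : ∀ i j, A i j = A j i)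
    (c p : Fin n → ℝ) (P : ℝ) (hP : 0 < P) (hPc : P = ∑ i, c i ^ 2)
    (htr : ∑ i, A i i = -P) (hp : ∀ i, p i = ∑ j, c j * A i j) (s W : ℝ)
    (hs : s = (∑ i, c i * p i) / P) (hW : W = (∑ i, p i ^ 2) / P) :
    (P + s)^2 / n ≤ (∑ i, ∑ j, A i j ^ 2) - 2 * W + s^2 ∧ s^2 ≤ W := by
  constructor
  · have hcp : ∑ i, c i * p i = s * P := by rw [hs]; field_simp
    have hpp : ∑ i, p i ^ 2 = W * P := by rw [hW]; field_simp
    let R : Fin n → Fin n → ℝ := fun i j => A i j - (c i * p j + p i * c j) / P + s * (c i * c j) / P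
    have hR2 : ∑ i, ∑ j, R i j ^ 2 = (∑ i, ∑ j, A i j ^ 2) - 2 * W + s^2 := by
      have hAcp : ∑ i, ∑ j, A i j * (c i * p j) = W * P := by
        rw [Finset.sum_comm, ← hpp]
        refine Finset.sum_congr rfl fun j _ => ?_
        rw [sq]; nth_rewrite 2 [hp j]; rw [Finset.sum_mul]
        refine Finset.sum_congr rfl fun i _ => ?_
        rw [hA i j]; ring
      have hApc : ∑ i, ∑ j, A i j * (p i * c j) = W * P := by
        rw [← hpp]
        refine Finset.sum_congr rfl fun j _ => ?_
        rw [sq]; nth_rewrite 3 [hp j]; rw [Finset.mul_sum]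
        refine Finset.sum_congr rfl fun i _ => ?_
        ring
      have hAcc : ∑ i, ∑ j, A i j * (c i * c j) = s * P := by
        rw [← hcp]
        refine Finset.sum_congr rfl fun j _ => ?_
        rw [hp j, Finset.mul_sum]
        refine Finset.sum_congr rfl fun i _ => ?_
        ring
      have hccpp : ∑ i, ∑ j, (c i ^ 2 * p j ^ 2) = P * (W * P) := by
        rw [← Finset.sum_mul_sum, ← hPc, hpp]
      have hppcc : ∑ i, ∑ j, (p i ^ 2 * c j ^ 2) = (W * P) * P := by
        rw [← Finset.sum_mul_sum, ← hPc, hpp]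
      have hcccc : ∑ i, ∑ j, (c i ^ 2 * c j ^ 2) = P * P := by
        rw [← Finset.sum_mul_sum, ← hPc]
      have hcpcp : ∑ i, ∑ j, ((c i * p i) * (c j * p j)) = (s * P) * (s * P) := by
        rw [← Finset.sum_mul_sum, hcp]
      have hcccp : ∑ i, ∑ j, (c i ^ 2 * (c j * p j)) = P * (s * P) := by
        rw [← Finset.sum_mul_sum, hcp, ← hPc]
      have hcpcc : ∑ i, ∑ j, ((c i * p i) * c j ^ 2) = (s * P) * P := by
        rw [← Finset.sum_mul_sum, hcp, ← hPc]
      have expand : ∀ i j, R i j ^ 2 = A i j ^ 2 - 2 / P * (A i j * (c i * p j))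
          - 2 / P * (A i j * (p i * c j)) + 2 * s / P * (A i j * (c i * c j))
          + 1 / P^2 * (c i ^ 2 * p j ^ 2) + 1 / P^2 * (p i ^ 2 * c j ^ 2)
          + 2 / P^2 * ((c i * p i) * (c j * p j)) + s^2 / P^2 * (c i ^ 2 * c j ^ 2)
          - 2 * s / P^2 * (c i ^ 2 * (c j * p j)) - 2 * s / P^2 * ((c i * p i) * c j ^ 2) := by
        intro i j; simp only [R]; field_simp; ring
      have pull : ∀ (a : ℝ) (f : Fin n → Fin n → ℝ), ∑ i, ∑ j, a * f i j = a * ∑ i, ∑ j, f i j := by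
        intro a f; simp only [Finset.mul_sum]
      simp only [expand, Finset.sum_add_distrib, Finset.sum_sub_distrib, pull,
        hAcp, hApc, hAcc, hccpp, hppcc, hcccc, hcpcp, hcccp, hcpcc]
      field_simp; ring
    have hRt : ∑ i, R i i = -(P + s) := by
      have : ∀ i, R i i = A i i - 2 / P * (c i * p i) + s / P * c i ^ 2 := by
        intro i; simp only [R]; field_simp; ring
      simp only [this, Finset.sum_add_distrib, Finset.sum_sub_distrib, ← Finset.mul_sum, htr, hcp, ← hPc]
      field_simp; ring
    rw [← hR2, div_le_iff₀ (by exact_mod_cast hn)]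
    have cs := sq_sum_le_card_mul_sum_sq (s := Finset.univ) (f := fun i => R i i)
    rw [hRt] at cs
    simp only [Finset.card_univ, Fintype.card_fin] at cs
    have diag : ∑ i, R i i ^ 2 ≤ ∑ i, ∑ j, R i j ^ 2 :=
      Finset.sum_le_sum fun i _ =>
        Finset.single_le_sum (f := fun j => R i j ^ 2) (fun j _ => sq_nonneg _) (Finset.mem_univ i)
    have : (0:ℝ) < n := by exact_mod_cast hn
    nlinarith
  · have cs := Finset.sum_mul_sq_le_sq_mul_sq Finset.univ c p
    rw [← hPc] at cs
    rw [hs, hW, div_pow, div_le_div_iff₀ (by positivity) hP]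
    nlinarith
theorem det_hasDerivAt {n : ℕ} (H : ℝ → Matrix (Fin n) (Fin n) ℝ) (H1 : Matrix (Fin n) (Fin n) ℝ) (t : ℝ)
    (h : ∀ i j, HasDerivAt (fun t => H t i j) (H1 i j) t) :
    HasDerivAt (fun t => (H t).det) ((H t).adjugate * H1).trace t := by
  have e : (fun t => (H t).det) = fun t => ∑ σ : Equiv.Perm (Fin n), ((Equiv.Perm.sign σ : ℤ) : ℝ) * ∏ i, H t (σ i) i := by
    funext t; rw [Matrix.det_apply']
  rw [e]
  have hd : HasDerivAt (fun t => ∑ σ : Equiv.Perm (Fin n), ((Equiv.Perm.sign σ : ℤ) : ℝ) * ∏ i, H t (σ i) i)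
      (∑ σ : Equiv.Perm (Fin n), ((Equiv.Perm.sign σ : ℤ) : ℝ) *
        ∑ i, (∏ j ∈ Finset.univ.erase i, H t (σ j) j) • H1 (σ i) i) t := by
    apply HasDerivAt.fun_sum
    intro σ _
    apply HasDerivAt.const_mul
    exact HasDerivAt.fun_finsetProd (fun i _ => h (σ i) i)
  convert hd using 1
  have : ((H t).adjugate * H1).trace = ∑ i, ((H t).updateCol i (fun k => H1 k i)).det := by
    rw [Matrix.trace]
    refine Finset.sum_congr rfl fun i _ => ?_
    rw [← Matrix.cramer_apply, Matrix.cramer_eq_adjugate_mulVec]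
    rfl
  rw [this]
  simp only [Matrix.det_apply', Finset.mul_sum]
  rw [Finset.sum_comm]
  refine Finset.sum_congr rfl fun σ _ => Finset.sum_congr rfl fun i _ => ?_
  rw [← Finset.mul_prod_erase Finset.univ _ (Finset.mem_univ i)]
  rw [Matrix.updateCol_self, smul_eq_mul, mul_comm (H1 (σ i) i)]
  congr 2
  refine Finset.prod_congr rfl fun j hj => ?_
  rw [Matrix.updateCol_ne (Finset.ne_of_mem_erase hj)]

theorem det_second {n : ℕ} (H H1 : ℝ → Matrix (Fin n) (Fin n) ℝ) (H2 : Matrix (Fin n) (Fin n) ℝ)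
    (h1 : ∀ t i j, HasDerivAt (fun t => H t i j) (H1 t i j) t)
    (h2 : ∀ i j, HasDerivAt (fun t => H1 t i j) (H2 i j) 0)
    (h0 : H 0 = 1) (φ φ1 : ℝ → ℝ) (φ2 : ℝ) (hφ1 : ∀ t, HasDerivAt φ (φ1 t) t)
    (hφ2 : HasDerivAt φ1 φ2 0) (hdet : ∀ t, (H t).det = Real.exp (φ t)) :
    (H1 0).trace = φ1 0 ∧ H2.trace = φ2 + (H1 0 * H1 0).trace := by
  have hd := fun t => det_hasDerivAt H (H1 t) t (h1 t)
  have he : ∀ t, HasDerivAt (fun t => (H t).det) ((H t).det * φ1 t) t := by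
    intro t
    simp only [hdet]
    exact (hφ1 t).exp
  have key : ∀ t, ((H t).adjugate * H1 t).trace = (H t).det * φ1 t := fun t => (hd t).unique (he t)
  have first : (H1 0).trace = φ1 0 := by
    have := key 0
    simpa [h0] using this
  refine ⟨first, ?_⟩
  -- derivative of the adjugate
  have hadj : ∀ i j, ∃ c, HasDerivAt (fun t => (H t).adjugate i j) c 0 := by
    intro i j
    simp only [Matrix.adjugate_apply]
    refine ⟨_, det_hasDerivAt (fun t => (H t).updateRow j (Pi.single i 1))
      ((H1 0).updateRow j 0) 0 ?_⟩
    intro a b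
    by_cases hab : a = j
    · subst hab
      simp only [Matrix.updateRow_self]
      simpa using hasDerivAt_const (0:ℝ) ((Pi.single i 1 : Fin n → ℝ) b)
    · simp only [Matrix.updateRow_ne hab]
      exact h1 0 a b
  choose K hK using hadj
  have hKval : ∀ i j, K i j = (H1 0).trace * (1 : Matrix (Fin n) (Fin n) ℝ) i j - H1 0 i j := by
    intro i j
    have a1 : HasDerivAt (fun t => ((H t).adjugate * H t) i j)
        (∑ k, (K i k * H 0 k j + (H 0).adjugate i k * H1 0 k j)) 0 := by
      simp only [Matrix.mul_apply]
      exact HasDerivAt.fun_sum fun k _ => (hK i k).mul (h1 0 k j)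
    have a2 : HasDerivAt (fun t => ((H t).adjugate * H t) i j)
        (((H 0).adjugate * H1 0).trace * (1 : Matrix (Fin n) (Fin n) ℝ) i j) 0 := by
      simp only [Matrix.adjugate_mul, Matrix.smul_apply, smul_eq_mul]
      exact (hd 0).mul_const _
    have := a1.unique a2
    simp only [h0, Matrix.adjugate_one, Finset.sum_add_distrib, Matrix.one_mul, Matrix.one_apply, mul_ite, ite_mul, mul_one, mul_zero, zero_mul, one_mul,
      Finset.sum_ite_eq, Finset.sum_ite_eq', Finset.mem_univ, if_true] at this ⊢
    linarith
  have b1 : HasDerivAt (fun t => ((H t).adjugate * H1 t).trace)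
      (∑ i, ∑ k, (K i k * H1 0 k i + (H 0).adjugate i k * H2 k i)) 0 := by
    simp only [Matrix.trace, Matrix.diag, Matrix.mul_apply]
    exact HasDerivAt.fun_sum fun i _ => HasDerivAt.fun_sum fun k _ => (hK i k).mul (h2 k i)
  have b2 : HasDerivAt (fun t => ((H t).adjugate * H1 t).trace)
      ((H 0).det * φ1 0 * φ1 0 + (H 0).det * φ2) 0 := by
    simp only [key]
    exact (he 0).mul hφ2
  have := b1.unique b2
  have e1 : ∑ i, ∑ k, K i k * H1 0 k i = (H1 0).trace ^ 2 - (H1 0 * H1 0).trace := by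
    simp only [hKval, sub_mul, Finset.sum_sub_distrib]
    congr 1
    simp only [Matrix.one_apply, mul_ite, ite_mul, mul_one, mul_zero, zero_mul, 
      Finset.sum_ite_eq, Finset.mem_univ, if_true, ← Finset.mul_sum]
    rw [sq]; rfl
  have e2 : ∑ i, ∑ k, (H 0).adjugate i k * H2 k i = H2.trace := by
    have : ((H 0).adjugate * H2).trace = H2.trace := by simp [h0]
    rw [← this]; rfl
  simp only [Finset.sum_add_distrib] at this
  rw [e1, e2, h0, first] at this
  simp at this
  linarith

/-- second-order necessary condition -/
theorem second_order_max (ψ ψ1 : ℝ → ℝ) (c : ℝ) (hmax : IsLocalMax ψ 0)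
    (h1 : ∀ᶠ t in 𝓝 (0:ℝ), HasDerivAt ψ (ψ1 t) t) (h2 : HasDerivAt ψ1 c 0) : ψ1 0 = 0 ∧ c ≤ 0 := by
  have h10 := h1.self_of_nhds
  have z := hmax.hasDerivAt_eq_zero h10
  refine ⟨z, ?_⟩
  by_contra hc
  push Not at hc
  have e : deriv ψ =ᶠ[𝓝 0] ψ1 := h1.mono fun t ht => ht.deriv
  have dd : deriv (deriv ψ) 0 = c := by rw [e.deriv_eq, h2.deriv]
  have hmin := isLocalMin_of_deriv_deriv_pos (f := ψ) (x₀ := 0) (by rw [dd]; exact hc)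
    (by rw [h10.deriv, z]) h10.continuousAt
  have hconst : ψ =ᶠ[𝓝 0] fun _ => ψ 0 := by
    filter_upwards [hmin, hmax] with t a b using le_antisymm b a
  have : deriv (deriv ψ) 0 = 0 := by
    rw [hconst.deriv.deriv_eq]; simp
  linarith
open scoped MatrixOrder in
theorem posDef_factor {n : ℕ} (H : Matrix (Fin n) (Fin n) ℝ) (hH : H.PosDef) :
    ∃ T : Matrix (Fin n) (Fin n) ℝ, Tᵀ * H * T = 1 ∧ T.det ≠ 0 := by
  have h0 : (0 : Matrix (Fin n) (Fin n) ℝ) ≤ H := Matrix.nonneg_iff_posSemidef.2 hH.posSemidef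
  obtain ⟨B, hB⟩ := CStarAlgebra.nonneg_iff_eq_star_mul_self.1 h0
  have hdet : IsUnit B.det := by
    have := hH.det_pos
    rw [hB, Matrix.det_mul] at this
    exact isUnit_iff_ne_zero.2 (fun h => by simp [h] at this)
  refine ⟨B⁻¹, ?_, ?_⟩
  · rw [hB, Matrix.star_eq_conjTranspose, Matrix.conjTranspose_eq_transpose_of_trivial, ← Matrix.mul_assoc,
      ← Matrix.transpose_mul, Matrix.mul_nonsing_inv _ hdet, Matrix.transpose_one, Matrix.one_mul,
      Matrix.mul_nonsing_inv _ hdet]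
  · exact (Matrix.isUnit_nonsing_inv_det _ hdet).ne_zero

def dd {n : ℕ} (w : Fin n → ℝ) (f : (Fin n → ℝ) → ℝ) : (Fin n → ℝ) → ℝ :=
  fun x => fderiv ℝ f x w

section
variable {n : ℕ} {f : (Fin n → ℝ) → ℝ}

theorem dd_smooth (w : Fin n → ℝ) (hf : ContDiff ℝ (⊤ : ℕ∞) f) : ContDiff ℝ (⊤ : ℕ∞) (dd w f) := by
  unfold dd
  exact (hf.fderiv_right (m := (⊤ : ℕ∞)) (by simp)).clm_apply contDiff_const

theorem sm_diff (hf : ContDiff ℝ (⊤ : ℕ∞) f) (x) : DifferentiableAt ℝ f x :=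
  hf.differentiable (by simp) x

theorem dd_line (hf : ContDiff ℝ (⊤ : ℕ∞) f) (x w : Fin n → ℝ) (t : ℝ) :
    HasDerivAt (fun t : ℝ => f (x + t • w)) (dd w f (x + t • w)) t := by
  have h1 : HasDerivAt (fun t : ℝ => x + t • w) w t := by
    simpa using ((hasDerivAt_id t).smul_const w).const_add x
  exact (sm_diff hf _).hasFDerivAt.comp_hasDerivAt t h1

theorem dd_comm (w z : Fin n → ℝ) (hf : ContDiff ℝ (⊤ : ℕ∞) f) : dd w (dd z f) = dd z (dd w f) := by
  funext x
  have hs : IsSymmSndFDerivAt ℝ f x := hf.contDiffAt.isSymmSndFDerivAt (by rw [minSmoothness_of_isRCLikeNormedField]; exact WithTop.coe_le_coe.2 (le_top : (2:ℕ∞) ≤ ⊤))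
  have hd : DifferentiableAt ℝ (fderiv ℝ f) x :=
    (hf.fderiv_right (m := (⊤ : ℕ∞)) (by simp)).differentiable (by simp) x
  have e : ∀ a b : Fin n → ℝ, dd a (dd b f) x = fderiv ℝ (fderiv ℝ f) x a b := by
    intro a b
    unfold dd
    rw [fderiv_clm_apply hd (differentiableAt_const _)]
    simp
  rw [e, e]
  exact hs w z

theorem dd_sum_dir {m : ℕ} (c : Fin m → ℝ) (b : Fin m → Fin n → ℝ) (f : (Fin n → ℝ) → ℝ) :
    dd (∑ j, c j • b j) f = fun x => ∑ j, c j * dd (b j) f x := by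
  funext x
  simp [dd, map_sum]

theorem dd_sum_fun {m : ℕ} (c : Fin m → ℝ) (g : Fin m → (Fin n → ℝ) → ℝ) (w : Fin n → ℝ)
    (hg : ∀ j, ContDiff ℝ (⊤ : ℕ∞) (g j)) :
    dd w (fun x => ∑ j, c j * g j x) = fun x => ∑ j, c j * dd w (g j) x := by
  funext x
  unfold dd
  rw [fderiv_fun_sum (fun j _ => (sm_diff (hg j) x).const_mul (c j))]
  simp only [_root_.sum_apply]
  refine Finset.sum_congr rfl fun j _ => ?_
  rw [fderiv_const_mul (sm_diff (hg j) x)]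
  simp

theorem dd_eq_sum_pd (w : Fin n → ℝ) (f : (Fin n → ℝ) → ℝ) :
    dd w f = fun x => ∑ j, w j * dd (Pi.single j 1) f x := by
  conv_lhs => rw [show w = ∑ j, w j • (Pi.single j 1 : Fin n → ℝ) from by
    funext i; simp [Finset.sum_apply, Pi.single_apply]]
  exact dd_sum_dir _ _ _
end

theorem line_max (P P1 U U1 V V1 : ℝ → ℝ) (P2 U2 V2 C k θ M : ℝ)
    (hP1 : ∀ t, HasDerivAt P (P1 t) t) (hP2 : HasDerivAt P1 P2 0)
    (hU1 : ∀ t, HasDerivAt U (U1 t) t) (hU2 : HasDerivAt U1 U2 0)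
    (hV1 : ∀ t, HasDerivAt V (V1 t) t) (hV2 : HasDerivAt V1 V2 0)
    (hP : ∀ t, 0 < P t) (hτ : U 0 < C)
    (hmax : IsLocalMax (fun t => Real.log (P t) + k * Real.log (C - U t)
      - M * Real.log (1 + Real.exp (θ * V t))) 0) (σ : ℝ)
    (hσ : σ = Real.exp (θ * V 0) / (1 + Real.exp (θ * V 0))) :
    P1 0 / P 0 - k * (U1 0 / (C - U 0)) - M * θ * σ * V1 0 = 0 ∧
    P2 / P 0 - P1 0 ^ 2 / P 0 ^ 2 - k * (U2 / (C - U 0) + U1 0 ^ 2 / (C - U 0) ^ 2)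
      - M * θ * (θ * σ * (1 - σ) * V1 0 ^ 2 + σ * V2) ≤ 0 := by
  have hev : ∀ᶠ t in 𝓝 (0:ℝ), 0 < C - U t := by
    have : ContinuousAt (fun t => C - U t) 0 := continuousAt_const.sub (hU1 0).continuousAt
    exact this.eventually (lt_mem_nhds (by linarith))
  have hE1 : ∀ t, HasDerivAt (fun t => 1 + Real.exp (θ * V t)) (Real.exp (θ * V t) * (θ * V1 t)) t :=
    fun t => (((hV1 t).const_mul θ).exp).const_add 1
  have hEpos : ∀ t, 0 < 1 + Real.exp (θ * V t) := fun t => by positivity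
  have h1 : ∀ᶠ t in 𝓝 (0:ℝ), HasDerivAt (fun t => Real.log (P t) + k * Real.log (C - U t)
      - M * Real.log (1 + Real.exp (θ * V t)))
      (P1 t / P t + k * (-(U1 t) / (C - U t)) -
        M * ((Real.exp (θ * V t) * (θ * V1 t)) / (1 + Real.exp (θ * V t)))) t := by
    filter_upwards [hev] with t ht
    exact (((hP1 t).log (hP t).ne').add ((((hU1 t).const_sub C).log ht.ne').const_mul k)).sub
      (((hE1 t).log (hEpos t).ne').const_mul M)
  have hτ' : 0 < C - U 0 := by linarith
  have h2 := ((hP2.div (hP1 0) (hP 0).ne').add (((hU2.neg).div ((hU1 0).const_sub C) hτ'.ne').const_mul k)).sub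
      (((((hV1 0).const_mul θ).exp.mul (hV2.const_mul θ)).div (hE1 0) (hEpos 0).ne').const_mul M)
  obtain ⟨r1, r2⟩ := second_order_max _ _ _ hmax h1 h2
  have hE := hEpos 0
  have hP0 := hP 0
  constructor
  · refine Eq.trans ?_ r1
    rw [hσ]; ring
  · refine le_trans (le_of_eq ?_) r2
    rw [hσ]; simp only [Pi.neg_apply, Pi.mul_apply]; field_simp; ring

theorem dd_hess {n : ℕ} {u : (Fin n → ℝ) → ℝ} (hu : ContDiff ℝ (⊤ : ℕ∞) u)
    (T : Matrix (Fin n) (Fin n) ℝ) (x : Fin n → ℝ) (i j : Fin n) :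
    (Tᵀ * hess u x * T) i j = dd (Tᵀ i) (dd (Tᵀ j) u) x := by
  rw [dd_eq_sum_pd (Tᵀ j) u, dd_sum_fun _ _ _ (fun l => dd_smooth _ hu)]
  simp only [Matrix.mul_apply]
  refine Finset.sum_congr rfl fun l _ => ?_
  rw [dd_eq_sum_pd (Tᵀ i), mul_comm]
  rfl

theorem dd_dd_pos {n : ℕ} {u : (Fin n → ℝ) → ℝ} (hu : ContDiff ℝ (⊤ : ℕ∞) u)
    (hconv : ∀ x : Fin n → ℝ, (hess u x).PosDef) (w : Fin n → ℝ) (hw : w ≠ 0) (x : Fin n → ℝ) :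
    0 < dd w (dd w u) x := by
  have := (hconv x).dotProduct_mulVec_pos hw
  refine lt_of_lt_of_eq this (Eq.symm ?_)
  rw [dd_eq_sum_pd w u, dd_sum_fun _ _ _ (fun l => dd_smooth _ hu)]
  simp only [dd_eq_sum_pd w, Finset.mul_sum, dotProduct, Matrix.mulVec]
  rw [Finset.sum_comm]
  refine Finset.sum_congr rfl fun l _ => Finset.sum_congr rfl fun k _ => ?_
  have e : hess u x l k = dd (Pi.single l 1) (dd (Pi.single k 1) u) x := rfl
  rw [e]
  simp only [star_trivial]
  ring

theorem point_bound {n : ℕ} (hn : 2 ≤ n) {u : (Fin n → ℝ) → ℝ} (hu : ContDiff ℝ (⊤ : ℕ∞) u)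
    (hconv : ∀ x : Fin n → ℝ, (hess u x).PosDef) (d : Fin n → ℝ) (d0 : ℝ)
    (hpde : ∀ ξ : Fin n → ℝ, (hess u ξ).det = Real.exp (-(dd d u ξ) - d0)) (hd : d ≠ 0)
    (C : ℝ) (p : Fin n → ℝ) (hp : u p < C)
    (hmax : IsLocalMax (fun x => Real.log (dd d (dd d u) x) + (64 * (n:ℝ)^3) * Real.log (C - u x)
      - (2 * (n:ℝ)^2) * Real.log (1 + Real.exp ((2 / (n:ℝ)) * dd d u x))) p) :
    dd d (dd d u) p * (C - u p) ≤ 128 * (n:ℝ)^5 := by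
  have hn' : (2:ℝ) ≤ n := by exact_mod_cast hn
  have hn0 : (0:ℝ) < n := by linarith
  obtain ⟨T, hT, hTdet⟩ := posDef_factor _ (hconv p)
  set b : Fin n → Fin n → ℝ := fun i => Tᵀ i with hb
  have hTu : IsUnit T.det := isUnit_iff_ne_zero.2 hTdet
  set c : Fin n → ℝ := T⁻¹ *ᵥ d with hc
  have hdc : d = ∑ j, c j • b j := by
    have : T *ᵥ c = d := by rw [hc, Matrix.mulVec_mulVec, Matrix.mul_nonsing_inv _ hTu, Matrix.one_mulVec]
    rw [← this]
    funext i
    simp only [Matrix.mulVec, dotProduct, Finset.sum_apply, Pi.smul_apply, smul_eq_mul, hb, Matrix.transpose_apply]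
    exact Finset.sum_congr rfl fun j _ => mul_comm _ _
  have s1 : ∀ w, ContDiff ℝ (⊤ : ℕ∞) (dd w u) := fun w => dd_smooth w hu
  have s2 : ∀ w z, ContDiff ℝ (⊤ : ℕ∞) (dd w (dd z u)) := fun w z => dd_smooth w (s1 z)
  have s3 : ∀ w z y, ContDiff ℝ (⊤ : ℕ∞) (dd w (dd z (dd y u))) := fun w z y => dd_smooth w (s2 z y)
  have horth : ∀ i j, dd (b i) (dd (b j) u) p = (1 : Matrix (Fin n) (Fin n) ℝ) i j := by
    intro i j; rw [← hT, dd_hess hu]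
  have hdu : dd d u = fun x => ∑ j, c j * dd (b j) u x := by
    conv_lhs => rw [hdc]
    exact dd_sum_dir _ _ _
  have hidu : ∀ i, dd (b i) (dd d u) = fun x => ∑ j, c j * dd (b i) (dd (b j) u) x := by
    intro i; rw [hdu]; exact dd_sum_fun _ _ _ fun j => s1 _
  set A : Fin n → Fin n → ℝ := fun i j => dd d (dd (b i) (dd (b j) u)) p with hA
  have hAsymm : ∀ i j, A i j = A j i := by
    intro i j; simp only [hA]; rw [dd_comm (b i) (b j) hu]
  have hV1 : ∀ i, dd (b i) (dd d u) p = c i := by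
    intro i; rw [hidu]; simp [horth, Matrix.one_apply]
  have hPc : dd d (dd d u) p = ∑ i, c i ^ 2 := by
    conv_lhs => rw [hdc]
    rw [dd_sum_dir]
    rw [← hdc]
    simp only [hV1, sq]
  have hpi : ∀ i, dd (b i) (dd d (dd d u)) p = ∑ j, c j * A i j := by
    intro i
    rw [dd_comm _ _ (s1 d), hidu, dd_sum_fun _ _ _ (fun j => s2 _ _)]
  have hv : dd d u p = ∑ i, c i * dd (b i) u p := by rw [hdu]
  have hPd : dd d (dd d (dd d u)) p = ∑ i, c i * dd (b i) (dd d (dd d u)) p := by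
    conv_lhs => rw [hdc]
    rw [dd_sum_dir]
    rw [← hdc]
  -- the equation along the direction d
  have hdetB : ∀ x, (Matrix.of fun i j => dd (b i) (dd (b j) u) x : Matrix (Fin n) (Fin n) ℝ).det
      = Real.exp (Real.log (T.det ^ 2) - dd d u x - d0) := by
    intro x
    have : (Matrix.of fun i j => dd (b i) (dd (b j) u) x : Matrix (Fin n) (Fin n) ℝ) = Tᵀ * hess u x * T := by
      ext i j; rw [dd_hess hu]; rfl
    rw [this, Matrix.det_mul, Matrix.det_mul, Matrix.det_transpose, hpde,
      show Real.log (T.det ^ 2) - dd d u x - d0 = Real.log (T.det^2) + (-(dd d u x) - d0) by ring,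
      Real.exp_add, Real.exp_log (by positivity)]
    ring
  have hz : p + (0:ℝ) • d = p := by simp
  obtain ⟨E1, E2⟩ := det_second
    (fun t => Matrix.of fun i j => dd (b i) (dd (b j) u) (p + t • d))
    (fun t => Matrix.of fun i j => dd d (dd (b i) (dd (b j) u)) (p + t • d))
    (Matrix.of fun i j => dd d (dd d (dd (b i) (dd (b j) u))) p)
    (fun t i j => dd_line (s2 _ _) p d t)
    (fun i j => by simpa using dd_line (s3 d (b i) (b j)) p d 0)
    (by ext i j; simp [horth])
    (fun t => Real.log (T.det ^ 2) - dd d u (p + t • d) - d0)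
    (fun t => - dd d (dd d u) (p + t • d)) (- dd d (dd d (dd d u)) p)
    (fun t => ((dd_line (s1 d) p d t).const_sub _).sub_const _)
    (by
      have h := (dd_line (s2 d d) p d 0).fun_neg
      rw [zero_smul, add_zero] at h
      exact h)
    (fun t => hdetB _)
  simp only [Matrix.trace, Matrix.diag, Matrix.of_apply, Matrix.mul_apply, hz] at E1 E2
  set P := dd d (dd d u) p with hPdef
  have hPpos : 0 < P := dd_dd_pos hu hconv d hd p
  have htr : ∑ i, A i i = -P := E1
  have hV2 : ∑ i, dd (b i) (dd (b i) (dd d u)) p = -P := by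
    rw [← E1]
    refine Finset.sum_congr rfl fun i _ => ?_
    rw [dd_comm (b i) d hu, dd_comm (b i) d (s1 _)]
  have hP2 : ∑ i, dd (b i) (dd (b i) (dd d (dd d u))) p
      = (∑ i, ∑ j, A i j ^ 2) - dd d (dd d (dd d u)) p := by
    have : ∑ i, ∑ j, A i j ^ 2 = ∑ i, ∑ j, A i j * A j i := by
      refine Finset.sum_congr rfl fun i _ => Finset.sum_congr rfl fun j _ => ?_
      rw [hAsymm j i]; ring
    rw [this]
    have e : ∑ i, dd (b i) (dd (b i) (dd d (dd d u))) p = ∑ i, dd d (dd d (dd (b i) (dd (b i) u))) p := by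
      refine Finset.sum_congr rfl fun i _ => ?_
      rw [dd_comm (b i) d (s1 d), dd_comm (b i) d hu, dd_comm (b i) d (s2 d (b i)), dd_comm (b i) d (s1 (b i))]
    rw [e, E2]; ring
  -- maximum conditions
  set τ := C - u p with hτ
  have hτpos : 0 < τ := by rw [hτ]; linarith
  set v := dd d u p with hvdef
  set σ := Real.exp ((2 / (n:ℝ)) * v) / (1 + Real.exp ((2 / (n:ℝ)) * v)) with hσ
  have hmx : ∀ i, dd (b i) (dd d (dd d u)) p / P - (64 * (n:ℝ)^3) * (dd (b i) u p / τ)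
        - (2 * (n:ℝ)^2) * (2 / (n:ℝ)) * σ * c i = 0 ∧
      dd (b i) (dd (b i) (dd d (dd d u))) p / P - dd (b i) (dd d (dd d u)) p ^ 2 / P ^ 2
        - (64 * (n:ℝ)^3) * (1 / τ + dd (b i) u p ^ 2 / τ ^ 2)
        - (2 * (n:ℝ)^2) * (2 / (n:ℝ)) * ((2 / (n:ℝ)) * σ * (1 - σ) * c i ^ 2
          + σ * dd (b i) (dd (b i) (dd d u)) p) ≤ 0 := by
    intro i
    have hz' : p + (0:ℝ) • b i = p := by simp
    have hcont : ContinuousAt (fun t : ℝ => p + t • b i) 0 := by fun_prop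
    have hm : IsLocalMax (fun t : ℝ => Real.log (dd d (dd d u) (p + t • b i))
        + (64 * (n:ℝ)^3) * Real.log (C - u (p + t • b i))
        - (2 * (n:ℝ)^2) * Real.log (1 + Real.exp ((2 / (n:ℝ)) * dd d u (p + t • b i)))) 0 := by
      have ht : Tendsto (fun t : ℝ => p + t • b i) (𝓝 0) (𝓝 p) := by
        have := hcont.tendsto; rwa [hz'] at this
      have := ht.eventually hmax
      unfold IsLocalMax IsMaxFilter
      simp only [hz']
      exact this
    have := line_max (fun t => dd d (dd d u) (p + t • b i)) (fun t => dd (b i) (dd d (dd d u)) (p + t • b i))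
      (fun t => u (p + t • b i)) (fun t => dd (b i) u (p + t • b i))
      (fun t => dd d u (p + t • b i)) (fun t => dd (b i) (dd d u) (p + t • b i))
      (dd (b i) (dd (b i) (dd d (dd d u))) p) (dd (b i) (dd (b i) u) p) (dd (b i) (dd (b i) (dd d u)) p)
      C (64 * (n:ℝ)^3) (2 / (n:ℝ)) (2 * (n:ℝ)^2)
      (fun t => dd_line (s2 _ _) _ _ _) (by simpa using dd_line (s3 (b i) d d) p (b i) 0)
      (fun t => dd_line hu _ _ _) (by simpa using dd_line (s1 (b i)) p (b i) 0)
      (fun t => dd_line (s1 _) _ _ _) (by simpa using dd_line (s2 (b i) d) p (b i) 0)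
      (fun t => dd_dd_pos hu hconv d hd _) (by simpa using hp) hm σ (by simp [hσ, hvdef])
    simp only [hz', hV1, horth, Matrix.one_apply_eq] at this
    exact this
  have hMθ : (2 * (n:ℝ)^2) * (2 / (n:ℝ)) = 4 * n := by field_simp; ring
  have hMθθ : (4 * (n:ℝ)) * (2 / (n:ℝ)) = 8 := by field_simp; ring
  set q : Fin n → ℝ := fun i => dd (b i) (dd d (dd d u)) p with hq
  set U : Fin n → ℝ := fun i => dd (b i) u p with hU
  obtain ⟨s, hs⟩ : ∃ s, s = (∑ i, c i * q i) / P := ⟨_, rfl⟩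
  obtain ⟨W, hW⟩ : ∃ W, W = (∑ i, q i ^ 2) / P := ⟨_, rfl⟩
  obtain ⟨m1, m2⟩ := matrix_ineq (by omega) A hAsymm c q P hPpos hPc htr hpi s W hs hW
  have hUi : ∀ i, (64 * (n:ℝ)^3) * (U i / τ) = q i / P - 4 * n * σ * c i := by
    intro i; have := (hmx i).1; rw [hMθ] at this; simp only [hq, hU]; linarith
  have hexp := Real.exp_pos ((2 / (n:ℝ)) * v)
  have hkpos : 0 < 64 * (n:ℝ)^3 := by positivity
  refine scalar_step n P s W (∑ i, ∑ j, A i j ^ 2) τ v (64 * (n:ℝ)^3 * v / τ) σ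
    (64 * (n:ℝ)^3 * ((∑ i, U i ^ 2) / τ^2)) hn' hPpos hτpos m1 m2 (by positivity)
    (by rw [hσ, div_lt_one (by positivity)]; linarith) ?_ ?_ ?_ ?_ ?_
  · intro hv0
    have : 1 ≤ Real.exp ((2 / (n:ℝ)) * v) := Real.one_le_exp (by positivity)
    rw [hσ, div_le_div_iff₀ (by norm_num) (by positivity)]; linarith
  · have : 64 * (n:ℝ)^3 * v / τ = ∑ i, c i * ((64 * (n:ℝ)^3) * (U i / τ)) := by
      rw [hv, Finset.mul_sum, Finset.sum_div]
      refine Finset.sum_congr rfl fun i _ => by ring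
    rw [this, hs, hPc, Finset.sum_div, Finset.mul_sum, ← Finset.sum_add_distrib]
    refine Finset.sum_congr rfl fun i _ => ?_
    rw [hUi, ← hPc]; ring
  · field_simp
  · have e : 64 * (n:ℝ)^3 * ((∑ i, U i ^ 2) / τ^2)
        = 1 / (64 * (n:ℝ)^3) * ∑ i, ((64 * (n:ℝ)^3) * (U i / τ)) ^ 2 := by
      rw [Finset.mul_sum, Finset.sum_div, Finset.mul_sum]
      refine Finset.sum_congr rfl fun i _ => by field_simp
    have e2 : ∑ i, ((64 * (n:ℝ)^3) * (U i / τ)) ^ 2 ≤ 2 * (W / P + (4*n*σ)^2 * P) := by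
      have : 2 * (W / P + (4*n*σ)^2 * P) = ∑ i, (2 * (q i / P)^2 + 2 * (4*n*σ * c i)^2) := by
        rw [hW]; nth_rewrite 3 [hPc]
        rw [Finset.sum_add_distrib, ← Finset.mul_sum, ← Finset.mul_sum]
        simp only [div_pow, mul_pow, ← Finset.sum_div, ← Finset.mul_sum]
        rw [div_div]; ring
      rw [this]
      refine Finset.sum_le_sum fun i _ => ?_
      rw [hUi]; nlinarith only [sq_nonneg (q i / P + 4*n*σ*c i)]
    rw [e]
    calc _ ≤ 1 / (64 * (n:ℝ)^3) * (2 * (W / P + (4*n*σ)^2 * P)) :=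
          mul_le_mul_of_nonneg_left e2 (by positivity)
      _ = _ := by ring
  · have hsum := Finset.sum_nonpos (s := Finset.univ) (fun i _ => (hmx i).2)
    simp only [hMθ, Finset.sum_sub_distrib, Finset.sum_add_distrib, ← Finset.mul_sum, ← Finset.sum_div,
      hP2, hV2, Finset.sum_const, Finset.card_univ, Fintype.card_fin, nsmul_eq_mul, ← hPc] at hsum
    have e1 : 64 * (n:ℝ)^3 * v / τ = s - 4 * n * σ * P := by
      have : 64 * (n:ℝ)^3 * v / τ = ∑ i, c i * ((64 * (n:ℝ)^3) * (U i / τ)) := by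
        rw [hv, Finset.mul_sum, Finset.sum_div]
        refine Finset.sum_congr rfl fun i _ => by ring
      rw [this, hs, hPc, Finset.sum_div, Finset.mul_sum, ← Finset.sum_sub_distrib]
      refine Finset.sum_congr rfl fun i _ => ?_
      rw [hUi, ← hPc]; ring
    rw [e1]
    have e3 : dd d (dd d (dd d u)) p / P = s := by rw [hs, hPd]
    have e4 : W / P = (∑ i, q i ^ 2) / P ^ 2 := by rw [hW, div_div, sq]
    rw [e4, ← e3]
    refine le_trans (le_of_eq ?_) hsum
    simp only [hq, hU]
    rw [sub_div, mul_add (4 * (n:ℝ))]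
    linear_combination (σ * (1-σ) * P) * hMθθ

theorem ray_facts {n : ℕ} {u : (Fin n → ℝ) → ℝ} (hu : ContDiff ℝ (⊤ : ℕ∞) u)
    (hconv : ∀ x : Fin n → ℝ, (hess u x).PosDef) (h0 : u 0 = 0) (hf0 : fderiv ℝ u 0 = 0)
    (w : Fin n → ℝ) (hw : w ≠ 0) :
    StrictConvexOn ℝ Set.univ (fun t : ℝ => u (t • w)) ∧ 0 < u w ∧ ∀ t : ℝ, 1 ≤ t → t * u w ≤ u (t • w) := by
  have h1 : ∀ t : ℝ, HasDerivAt (fun t : ℝ => u (t • w)) (dd w u (t • w)) t := by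
    intro t; simpa using dd_line hu 0 w t
  have h2 : ∀ t : ℝ, HasDerivAt (fun t : ℝ => dd w u (t • w)) (dd w (dd w u) (t • w)) t := by
    intro t; simpa using dd_line (dd_smooth w hu) 0 w t
  have hd1 : deriv (fun t : ℝ => u (t • w)) = fun t : ℝ => dd w u (t • w) := by
    funext t; exact (h1 t).deriv
  have hd2 : deriv (fun t : ℝ => dd w u (t • w)) = fun t : ℝ => dd w (dd w u) (t • w) := by
    funext t; exact (h2 t).deriv
  have hmono : StrictMono (fun t : ℝ => dd w u (t • w)) :=
    strictMono_of_deriv_pos fun t => by rw [hd2]; exact dd_dd_pos hu hconv w hw _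
  have hsc : StrictConvexOn ℝ Set.univ (fun t : ℝ => u (t • w)) := by
    apply StrictMono.strictConvexOn_univ_of_deriv
    · exact continuous_iff_continuousAt.2 fun t => (h1 t).continuousAt
    · rw [hd1]; exact hmono
  have hz : dd w u ((0:ℝ) • w) = 0 := by simp [dd, hf0]
  have hpos : 0 < u w := by
    have hm : StrictMonoOn (fun t : ℝ => u (t • w)) (Set.Ici 0) := by
      apply strictMonoOn_of_deriv_pos (convex_Ici 0)
      · exact (continuous_iff_continuousAt.2 fun t => (h1 t).continuousAt).continuousOn
      · intro t ht
        rw [interior_Ici] at ht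
        rw [hd1]
        have := hmono ht
        simp only [hz] at this
        exact this
    have := hm (Set.mem_Ici.2 le_rfl) (Set.mem_Ici.2 zero_le_one) zero_lt_one
    simpa [h0] using this
  refine ⟨hsc, hpos, fun t ht => ?_⟩
  have ht0 : 0 < t := by linarith
  have := hsc.convexOn.2 (Set.mem_univ (0:ℝ)) (Set.mem_univ t)
    (show (0:ℝ) ≤ 1 - 1/t by rw [sub_nonneg, div_le_one ht0]; exact ht) (show (0:ℝ) ≤ 1/t by positivity) (by ring)
  simp only [smul_eq_mul, mul_zero, zero_add, zero_smul, h0] at this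
  rw [one_div, inv_mul_cancel₀ ht0.ne', one_smul] at this
  calc t * u w ≤ t * (t⁻¹ * u (t • w)) := mul_le_mul_of_nonneg_left this ht0.le
    _ = _ := by rw [← mul_assoc, mul_inv_cancel₀ ht0.ne', one_mul]

theorem sublevel_compact {n : ℕ} {u : (Fin n → ℝ) → ℝ} (hn : 2 ≤ n) (hu : ContDiff ℝ (⊤ : ℕ∞) u)
    (hconv : ∀ x : Fin n → ℝ, (hess u x).PosDef) (h0 : u 0 = 0) (hf0 : fderiv ℝ u 0 = 0) (C : ℝ) :
    IsCompact {x | u x ≤ C} := by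
  have hcl : IsClosed {x | u x ≤ C} := isClosed_le hu.continuous continuous_const
  have : Nonempty (Fin n) := ⟨⟨0, by omega⟩⟩
  obtain ⟨z, hz, hzmin⟩ := (isCompact_sphere (0 : Fin n → ℝ) 1).exists_isMinOn
    (NormedSpace.sphere_nonempty.2 zero_le_one) hu.continuous.continuousOn
  have hzn : z ≠ 0 := by
    rintro rfl; simp at hz
  have hm : 0 < u z := (ray_facts hu hconv h0 hf0 z hzn).2.1
  refine Metric.isCompact_of_isClosed_isBounded hcl ?_
  refine (Metric.isBounded_closedBall (x := (0 : Fin n → ℝ)) (r := max 1 (C / u z))).subset ?_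
  intro x hx
  rw [mem_closedBall_zero_iff]
  by_cases hx1 : ‖x‖ ≤ 1
  · exact hx1.trans (le_max_left _ _)
  · push Not at hx1
    refine le_trans ?_ (le_max_right _ _)
    rw [le_div_iff₀ hm]
    have hxn : ‖x‖ ≠ 0 := by linarith
    have hx0 : x ≠ 0 := norm_ne_zero_iff.1 hxn
    set y := ‖x‖⁻¹ • x with hy
    have hyx : ‖x‖ • y = x := by rw [hy, smul_smul, mul_inv_cancel₀ hxn, one_smul]
    have hyn : ‖y‖ = 1 := by rw [hy, norm_smul, norm_inv, norm_norm, inv_mul_cancel₀ hxn]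
    have hy0 : y ≠ 0 := by rw [← norm_ne_zero_iff, hyn]; exact one_ne_zero
    have h3 := (ray_facts hu hconv h0 hf0 y hy0).2.2 ‖x‖ hx1.le
    rw [hyx] at h3
    have h4 : u z ≤ u y := hzmin (by simp [hyn])
    have h5 : u x ≤ C := hx
    have h6 : ‖x‖ * u z ≤ ‖x‖ * u y := mul_le_mul_of_nonneg_left h4 (norm_nonneg _)
    linarith

theorem P_bound {n : ℕ} (hn : 2 ≤ n) {u : (Fin n → ℝ) → ℝ} (hu : ContDiff ℝ (⊤ : ℕ∞) u)
    (hconv : ∀ x : Fin n → ℝ, (hess u x).PosDef) (d : Fin n → ℝ) (d0 : ℝ)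
    (hpde : ∀ ξ : Fin n → ℝ, (hess u ξ).det = Real.exp (-(dd d u ξ) - d0)) (hd : d ≠ 0)
    (h0 : u 0 = 0) (hf0 : fderiv ℝ u 0 = 0) (C : ℝ) (hC : 0 < C) :
    dd d (dd d u) 0 * C ≤ 128 * (n:ℝ)^5 * 2 ^ (2 * n ^ 2) := by
  have hnn : (0:ℝ) < n := by exact_mod_cast (by omega : 0 < n)
  have hPpos : ∀ x, 0 < dd d (dd d u) x := dd_dd_pos hu hconv d hd
  have hEpos : ∀ x, 0 < 1 + Real.exp ((2 / (n:ℝ)) * dd d u x) := fun x => by positivity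
  have hcomp := sublevel_compact hn hu hconv h0 hf0 C
  set F : (Fin n → ℝ) → ℝ := fun x => (C - u x) ^ (64 * n ^ 3) * dd d (dd d u) x /
    (1 + Real.exp ((2 / (n:ℝ)) * dd d u x)) ^ (2 * n ^ 2) with hF
  have c1 : Continuous (dd d u) := (dd_smooth d hu).continuous
  have c2 : Continuous (dd d (dd d u)) := (dd_smooth d (dd_smooth d hu)).continuous
  have c0 : Continuous u := hu.continuous
  have hFc : Continuous F := by
    refine Continuous.div (by fun_prop) (by fun_prop) fun x => (pow_pos (hEpos x) _).ne'
  obtain ⟨p, hp, hpmax⟩ := hcomp.exists_isMaxOn ⟨0, by simp [h0, hC.le]⟩ hFc.continuousOn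
  have hF0 : F 0 = C ^ (64 * n ^ 3) * dd d (dd d u) 0 / 2 ^ (2 * n ^ 2) := by
    have : dd d u 0 = 0 := by simp [dd, hf0]
    simp only [hF, this, h0]; norm_num
  have hF0pos : 0 < F 0 := by
    rw [hF0]; have := hPpos 0; positivity
  have hF0p : F 0 ≤ F p := hpmax (by simp [h0, hC.le])
  have hup : u p < C := by
    rcases lt_or_eq_of_le (show u p ≤ C from hp) with h | h
    · exact h
    · exfalso
      have : F p = 0 := by simp [hF, h]; omega
      linarith
  have hlogF : ∀ x, u x < C → Real.log (F x) = Real.log (dd d (dd d u) x)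
      + (64 * (n:ℝ)^3) * Real.log (C - u x)
      - (2 * (n:ℝ)^2) * Real.log (1 + Real.exp ((2 / (n:ℝ)) * dd d u x)) := by
    intro x hx
    have hx' : 0 < C - u x := by linarith
    simp only [hF]
    rw [Real.log_div (mul_pos (pow_pos hx' _) (hPpos x)).ne' (pow_pos (hEpos x) _).ne',
      Real.log_mul (pow_pos hx' _).ne' (hPpos x).ne', Real.log_pow, Real.log_pow]
    push_cast; ring
  have hFpos : ∀ x, u x < C → 0 < F x := by
    intro x hx
    have hx' : 0 < C - u x := by linarith
    exact div_pos (mul_pos (pow_pos hx' _) (hPpos x)) (pow_pos (hEpos x) _)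
  have hmax : IsLocalMax (fun x => Real.log (dd d (dd d u) x) + (64 * (n:ℝ)^3) * Real.log (C - u x)
      - (2 * (n:ℝ)^2) * Real.log (1 + Real.exp ((2 / (n:ℝ)) * dd d u x))) p := by
    have hev : ∀ᶠ x in 𝓝 p, u x < C := (isOpen_lt c0 continuous_const).mem_nhds hup
    filter_upwards [hev] with x hx
    rw [← hlogF x hx, ← hlogF p hup]
    exact Real.log_le_log (hFpos x hx) (hpmax (show u x ≤ C from hx.le))
  have hb := point_bound hn hu hconv d d0 hpde hd C p hup hmax
  have hup0 : 0 ≤ u p := by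
    by_cases hp0 : p = 0
    · rw [hp0, h0]
    · exact (ray_facts hu hconv h0 hf0 p hp0).2.1.le
  obtain ⟨k, hk⟩ : ∃ k, 64 * n ^ 3 = k + 1 :=
    ⟨64 * n ^ 3 - 1, by have : 0 < 64 * n ^ 3 := by positivity
                        omega⟩
  have hτ : 0 < C - u p := by linarith
  have hFp : F p ≤ C ^ k * (128 * (n:ℝ)^5) := by
    have e1 : F p ≤ (C - u p) ^ (64 * n ^ 3) * dd d (dd d u) p := by
      simp only [hF]
      refine div_le_self (mul_pos (pow_pos hτ _) (hPpos p)).le (one_le_pow₀ ?_)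
      linarith [Real.exp_pos ((2 / (n:ℝ)) * dd d u p)]
    refine e1.trans ?_
    rw [hk, pow_succ, mul_assoc, mul_comm (C - u p)]
    exact mul_le_mul (pow_le_pow_left₀ hτ.le (by linarith) _) hb
      (mul_pos (hPpos p) hτ).le (by positivity)
  have h7 := hF0p.trans hFp
  rw [hF0, hk, div_le_iff₀ (by positivity), pow_succ] at h7
  have hCk : 0 < C ^ k := by positivity
  refine le_of_mul_le_mul_left ?_ hCk
  calc _ = C ^ k * C * dd d (dd d u) 0 := by ring
    _ ≤ _ := h7
    _ = _ := by ring

theorem d_eq_zero_normalized {n : ℕ} (hn : 2 ≤ n) {u : (Fin n → ℝ) → ℝ} (hu : ContDiff ℝ (⊤ : ℕ∞) u)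
    (hconv : ∀ x : Fin n → ℝ, (hess u x).PosDef) (d : Fin n → ℝ) (d0 : ℝ)
    (hpde : ∀ ξ : Fin n → ℝ, (hess u ξ).det = Real.exp (-(dd d u ξ) - d0))
    (h0 : u 0 = 0) (hf0 : fderiv ℝ u 0 = 0) : d = 0 := by
  by_contra hd
  have hP := dd_dd_pos hu hconv d hd 0
  set K : ℝ := 128 * (n:ℝ)^5 * 2 ^ (2 * n ^ 2) with hK
  have hK0 : 0 ≤ K := by positivity
  have := P_bound hn hu hconv d d0 hpde hd h0 hf0 ((K + 1) / dd d (dd d u) 0) (by positivity)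
  rw [mul_div_cancel₀ _ hP.ne'] at this
  linarith

theorem d_eq_zero {n : ℕ} (hn : 2 ≤ n) {u : (Fin n → ℝ) → ℝ} (hu : ContDiff ℝ (⊤ : ℕ∞) u)
    (hconv : ∀ x : Fin n → ℝ, (hess u x).PosDef) (d : Fin n → ℝ) (d0 : ℝ)
    (hpde : ∀ ξ : Fin n → ℝ, (hess u ξ).det = Real.exp (-(dd d u ξ) - d0)) : d = 0 := by
  set L := fderiv ℝ u 0 with hL
  set g : (Fin n → ℝ) → ℝ := fun x => u x - u 0 - L x with hg
  have hgs : ContDiff ℝ (⊤ : ℕ∞) g := (hu.sub contDiff_const).sub L.contDiff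
  have hgf : ∀ x, fderiv ℝ g x = fderiv ℝ u x - L := by
    intro x
    exact (((sm_diff hu x).hasFDerivAt.sub_const (u 0)).sub L.hasFDerivAt).fderiv
  have hgd : ∀ w, dd w g = fun x => dd w u x - L w := by
    intro w; funext x; simp [dd, hgf]
  have hgh : ∀ x, hess g x = hess u x := by
    intro x
    ext i j
    change dd (Pi.single i 1) (dd (Pi.single j 1) g) x = dd (Pi.single i 1) (dd (Pi.single j 1) u) x
    rw [hgd]
    unfold dd
    rw [fderiv_sub_const]
  refine d_eq_zero_normalized hn hgs (fun x => by rw [hgh]; exact hconv x) d (d0 + L d) (fun x => ?_) ?_ ?_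
  · rw [hgh, hpde, hgd]; congr 1; ring
  · simp [hg]
  · rw [hgf, ← hL, sub_self]

/-- For any smooth strictly convex global solution of equation (1.4) on `ℝⁿ`,
the function `Φ` vanishes identically; equivalently `det D²u` is a positive
constant. -/
theorem Phi_vanishes_of_global_solution (n : ℕ) (hn : 2 ≤ n)
    (u : (Fin n → ℝ) → ℝ) (hu : ContDiff ℝ (⊤ : ℕ∞) u)
    (hconv : ∀ x : Fin n → ℝ, (hess u x).PosDef)
    (d : Fin n → ℝ) (d0 : ℝ)
    (hpde : ∀ ξ : Fin n → ℝ,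
      (hess u ξ).det = Real.exp (-(∑ i : Fin n, d i * pd i u ξ) - d0)) :
    (∀ ξ : Fin n → ℝ, PhiU u ξ = 0) ∧
      ∃ c : ℝ, 0 < c ∧ ∀ ξ : Fin n → ℝ, (hess u ξ).det = c := by
  have hd : d = 0 := by
    refine d_eq_zero hn hu hconv d d0 fun ξ => ?_
    rw [hpde, dd_eq_sum_pd]
    rfl
  have hdet : ∀ ξ : Fin n → ℝ, (hess u ξ).det = Real.exp (-d0) := by
    intro ξ; rw [hpde, hd]; simp
  have hrho : rhoU u = fun _ => Real.exp (-d0) ^ ((1 : ℝ) / (n + 2)) := by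
    funext ξ; simp only [rhoU, hdet]
  refine ⟨fun ξ => ?_, Real.exp (-d0), Real.exp_pos _, hdet⟩
  have hpd : ∀ i, pd i (rhoU u) ξ = 0 := by
    intro i; rw [hrho]; simp [pd]
  simp [PhiU, hpd]
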